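/- Let λ, λ′ > 0 and let p, p′ : ℕ → ℝ be probability mass functions with p(0) = p′(0) = 0 such that p′(i) > 0 whenever p(i) > 0 and KL(p^{∗n}, p′^{∗n}), V(p^{∗n}, p′^{∗n}) are finite for all n. Let q(i) = ∑_{n=0}^∞ e^{−λ} (λⁿ/n!) p^{∗n}(i) and q′(i) = ∑_{n=0}^∞ e^{−λ′} (λ′ⁿ/n!) p′^{∗n}(i). Then V(q, q′) ≤ 2 ∑_{n=0}^∞ e^{−λ} (λⁿ/n!) · (V(p^{∗n}, p′^{∗n}) + 2 KL(p^{∗n}, p′^{∗n})) + 2 V(Poisson(λ), Poisson(λ′)), where V(Poisson(λ), Poisson(λ′)) = ∑_{n=0}^∞ e^{−λ}(λⁿ/n!) (log((e^{−λ}λⁿ)/(e^{−λ′}λ′ⁿ)))². -/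

import Mathlib

open MeasureTheory
open scoped BigOperators Classical

noncomputable section

/-- Discrete convolution of two sequences. -/
def conv (a b : ℕ → ℝ) : ℕ → ℝ := fun i => ∑ k ∈ Finset.range (i + 1), a k * b (i - k)

/-- The sequence δ₀ with δ₀(0) = 1 and δ₀(k) = 0 for k ≥ 1. -/
def delta0 : ℕ → ℝ := fun i => if i = 0 then 1 else 0

/-- Convolution powers: a^{∗0} = δ₀, a^{∗(n+1)} = a^{∗n} ∗ a. -/
def convPow (a : ℕ → ℝ) : ℕ → ℕ → ℝ
  | 0 => delta0
  | n + 1 => conv (convPow a n) a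

/-- The ℓ¹ norm of a sequence. -/
def l1 (a : ℕ → ℝ) : ℝ := ∑' i, |a i|

/-- exp(a) = ∑_{j=0}^∞ a^{∗j}/j!, defined coordinatewise. -/
def expSeq (a : ℕ → ℝ) : ℕ → ℝ := fun i => ∑' j, convPow a j i / (Nat.factorial j : ℝ)

/-- p is a probability mass function on ℕ₀. -/
def IsPMF (p : ℕ → ℝ) : Prop := (∀ i, 0 ≤ p i) ∧ ∑' i, p i = 1

/-- Kullback–Leibler divergence. -/
def KL (u v : ℕ → ℝ) : ℝ := ∑' i, u i * Real.log (u i / v i)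

/-- The V divergence. -/
def Vd (u v : ℕ → ℝ) : ℝ := ∑' i, u i * (Real.log (u i / v i)) ^ 2

/-- Squared Hellinger distance. -/
def hellSq (u v : ℕ → ℝ) : ℝ := ∑' i, (Real.sqrt (u i) - Real.sqrt (v i)) ^ 2

/-- Hellinger distance. -/
def hell (u v : ℕ → ℝ) : ℝ := Real.sqrt (hellSq u v)

/-- The compound Poisson distribution of (λ, p). -/
def cpq (lam : ℝ) (p : ℕ → ℝ) : ℕ → ℝ :=
  fun i => ∑' n, Real.exp (-lam) * lam ^ n / (Nat.factorial n : ℝ) * convPow p n i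

lemma sq_div_four_le_exp_sub {u : ℝ} (hu : -2 ≤ u) : u ^ 2 / 4 ≤ Real.exp u - 1 - u := by
  have h1 : Real.exp u = Real.exp (u / 2) ^ 2 := by
    rw [← Real.exp_nat_mul]; congr 1; push_cast; ring
  have h2 := Real.add_one_le_exp (u / 2)
  nlinarith

lemma exp_neg_sub_le {a : ℝ} (ha : 0 ≤ a) : Real.exp (-a) - 1 + a ≤ a ^ 2 / 2 := by
  have h := Real.quadratic_le_exp_of_nonneg ha
  have h2 : Real.exp (-a) * Real.exp a = 1 := by rw [← Real.exp_add]; simp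
  have h3 : Real.exp (-a) * (1 + a + a ^ 2 / 2) ≤ 1 := by
    exact (mul_le_mul_of_nonneg_left h (Real.exp_pos _).le).trans_eq h2
  by_contra hc
  push Not at hc
  nlinarith [mul_lt_mul_of_pos_right hc (show 0 < 1 + a + a ^ 2 / 2 by positivity), sq_nonneg (a^2)]

lemma exp_neg_le_two_sub {s : ℝ} (h0 : 0 ≤ s) (h1 : s ≤ 7 / 4) : Real.exp (-s) ≤ 2 - s := by
  have h := Real.quadratic_le_exp_of_nonneg h0
  have h2 : Real.exp (-s) * Real.exp s = 1 := by rw [← Real.exp_add]; simp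
  have h3 : 1 ≤ (2 - s) * Real.exp s := by
    have : (2 - s) * (1 + s + s ^ 2 / 2) ≤ (2 - s) * Real.exp s :=
      mul_le_mul_of_nonneg_left h (by linarith)
    have : 0 ≤ s * (7/4 - s) * (7/4 + s) := by
      apply mul_nonneg (mul_nonneg _ _) <;> linarith
    nlinarith
  have := Real.exp_pos s
  nlinarith

/-- The squared positive part of `L` lies above a tangent line in the variable `exp (-L)`. -/
lemma tangent_posPart_sq {U L : ℝ} (hU : 0 ≤ U) :
    U ^ 2 + 2 * U - 2 * U * Real.exp U * Real.exp (-L) ≤ (max L 0) ^ 2 := by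
  have h : Real.exp U * Real.exp (-L) = Real.exp (U - L) := by rw [← Real.exp_add]; ring_nf
  rw [mul_assoc, h]
  have h1 := Real.add_one_le_exp (U - L)
  rcases le_total L 0 with hL | hL
  · rw [max_eq_right hL]
    have h2 := Real.quadratic_le_exp_of_nonneg (show 0 ≤ U - L by linarith)
    nlinarith [mul_nonneg hU hU, mul_nonneg hU (mul_nonneg hU hU),
      mul_nonneg hU (neg_nonneg.2 hL), mul_le_mul_of_nonneg_left h2 hU,
      mul_nonneg hU (sq_nonneg (U - L))]
  · rw [max_eq_left hL]
    rcases le_total L U with h3 | h3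
    · have h2 := Real.quadratic_le_exp_of_nonneg (show 0 ≤ U - L by linarith)
      nlinarith [mul_le_mul_of_nonneg_left h1 hU, sq_nonneg (U - L)]
    · nlinarith [mul_le_mul_of_nonneg_left h1 hU, sq_nonneg (U - L)]

lemma tangent_exp (U L : ℝ) :
    2 * U + 2 * (1 - Real.exp U) * Real.exp (-L) ≤ 2 * (Real.exp (-L) - 1 + L) := by
  have h : Real.exp U * Real.exp (-L) = Real.exp (U - L) := by rw [← Real.exp_add]; ring_nf
  have h1 := Real.add_one_le_exp (U - L)
  nlinarith

lemma exp_pooled {l u : ℝ} (hl : 2 ≤ l) (hu : 0 ≤ u) :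
    u ^ 2 ≤ l ^ 2 - 2 * l + 2 * l * Real.exp (-l) * Real.exp u := by
  have h : Real.exp (-l) * Real.exp u = Real.exp (u - l) := by rw [← Real.exp_add]; ring_nf
  rw [mul_assoc, h]
  rcases le_total (-2) (u - l) with h2 | h2
  · have := sq_div_four_le_exp_sub h2
    have : 2 * l * ((u - l)^2/4) ≤ 2 * l * (Real.exp (u - l) - 1 - (u - l)) :=
      mul_le_mul_of_nonneg_left this (by linarith)
    nlinarith [mul_nonneg (sub_nonneg.2 hl) (sq_nonneg (u - l))]
  · have := Real.exp_pos (u - l)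
    nlinarith [mul_pos (show 0 < l by linarith) this,
      mul_nonneg hu (show 0 ≤ l - u - 2 by linarith)]

/-- Coefficient of `exp (-t)` in the bound for `convexMajorant`. -/
def majExp (s : ℝ) : ℝ :=
  if s < 0 then 2 * Real.exp (-s) + 2 else if s ≤ 7 / 4 then 4 - 2 * s else 2 * Real.exp (-s)

/-- Constant coefficient in the bound for `convexMajorant`. -/
def majConst (s : ℝ) : ℝ :=
  if s < 0 then 2 * s - 4 else if s ≤ 7 / 4 then s ^ 2 - 4 + 2 * s else 2 * s ^ 2 - 4 * s + 4

/-- Coefficient of `exp (-t)` in the bound for the squared positive part. -/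
def posExp (s : ℝ) : ℝ := if s < 0 then 4 else if s ≤ 2 then 4 - 2 * s else 0

/-- Constant coefficient in the bound for the squared positive part. -/
def posConst (s : ℝ) : ℝ :=
  if s < 0 then -4 else if s ≤ 2 then s ^ 2 - 4 + 2 * s else 2 * s ^ 2 - 4 * s + 4

/-- A function of `L` that dominates `L ^ 2` and is convex as a function of `exp (-L)`. -/
def convexMajorant (L : ℝ) : ℝ := if L < 0 then 2 * (Real.exp (-L) - 1 + L) else L ^ 2

lemma convexMajorant_le (s t : ℝ) :
    convexMajorant (s + t) ≤ 2 * t ^ 2 + 4 * t + majConst s + majExp s * Real.exp (-t) := by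
  have hm : Real.exp (-(s + t)) = Real.exp (-s) * Real.exp (-t) := by
    rw [← Real.exp_add]; ring_nf
  have ht := Real.add_one_le_exp (-t)
  have hs := Real.add_one_le_exp (-s)
  have hst := Real.add_one_le_exp (-(s + t))
  have hst0 := Real.exp_pos (-(s + t))
  unfold convexMajorant majConst majExp
  split_ifs with h1 h2 h3 h3 h4
  · nlinarith
  · have h4 := exp_neg_le_two_sub (not_lt.1 h2) h3
    push Not at h2
    have h7 : s ^ 3 ≤ 49 / 16 * s := by
      have : 0 ≤ s * (7/4 - s) * (7/4 + s) := by
        apply mul_nonneg (mul_nonneg _ _) <;> linarith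
      nlinarith
    have hq := Real.quadratic_le_exp_of_nonneg h2
    have h6 : 2 + s - s ^ 3 / 2 ≤ (2 - s) * Real.exp s := by
      have : (2 - s) * (1 + s + s ^ 2 / 2) ≤ (2 - s) * Real.exp s :=
        mul_le_mul_of_nonneg_left hq (by linarith)
      nlinarith
    have h8 : Real.exp (-t) = Real.exp s * Real.exp (-(s + t)) := by
      rw [← Real.exp_add]; ring_nf
    have h9 : (2 + s - s ^ 3 / 2) * Real.exp (-(s + t)) ≤ (2 - s) * Real.exp (-t) := by
      rw [h8, ← mul_assoc]; exact mul_le_mul_of_nonneg_right h6 hst0.le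
    have h10 : (1 + s - s ^ 3 / 2) * (-(s + t) + 1) ≤
        (1 + s - s ^ 3 / 2) * Real.exp (-(s + t)) :=
      mul_le_mul_of_nonneg_left hst (by linarith)
    have h11 : 0 ≤ (2 * s - s ^ 3) + 4 * s := by linarith
    nlinarith [mul_nonneg h11 (show 0 ≤ -(s + t) by linarith), sq_nonneg (s + t),
      mul_nonneg (sq_nonneg s) (show 0 ≤ 3 - s by linarith)]
  · nlinarith [sq_nonneg (t + 1 / 2), sq_nonneg (s - 3 / 2)]
  · have := Real.exp_pos (-s)
    nlinarith [mul_pos this (Real.exp_pos (-t))]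
  · nlinarith [mul_nonneg (show 0 ≤ 4 - 2 * s by linarith)
      (show 0 ≤ Real.exp (-t) - 1 + t by linarith), sq_nonneg t]
  · nlinarith [sq_nonneg (t + 2 - s)]

lemma posPart_sq_le (s t : ℝ) :
    (max (s + t) 0) ^ 2 ≤ 2 * t ^ 2 + 4 * t + posConst s + posExp s * Real.exp (-t) := by
  have ht := Real.add_one_le_exp (-t)
  unfold posConst posExp
  rcases le_total (s + t) 0 with h | h
  · rw [max_eq_right h]
    split_ifs with h1 h2
    · nlinarith
    · nlinarith [mul_le_mul_of_nonneg_left ht (show 0 ≤ 4 - 2 * s by linarith), sq_nonneg (s + t)]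
    · nlinarith [sq_nonneg (t + 1), sq_nonneg (s - 1)]
  · rw [max_eq_left h]
    split_ifs with h1 h2
    · nlinarith
    · nlinarith [mul_le_mul_of_nonneg_left ht (show 0 ≤ 4 - 2 * s by linarith), sq_nonneg t]
    · nlinarith [sq_nonneg (t + 2 - s)]

lemma two_mul_exp_neg_le_majExp (s : ℝ) : 2 * Real.exp (-s) ≤ majExp s := by
  unfold majExp
  split_ifs with h1 h2
  · linarith
  · linarith [exp_neg_le_two_sub (not_lt.1 h1) h2]
  · rfl

lemma posExp_nonneg (s : ℝ) : 0 ≤ posExp s := by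
  unfold posExp; split_ifs <;> linarith

lemma majConst_add_majExp_le_quartic (s : ℝ) :
    majConst s + majExp s ≤ 2 * (Real.exp (-s) - 1 + s) + s ^ 2 / 2 + 3 / 128 * s ^ 4 := by
  unfold majConst majExp
  split_ifs with h1 h2
  · nlinarith [sq_nonneg s, sq_nonneg (s ^ 2)]
  · have h : 0 ≤ s := not_lt.1 h1
    have := sq_div_four_le_exp_sub (show -2 ≤ -s by linarith)
    nlinarith [sq_nonneg (s ^ 2)]
  · have h3 : s - 2 ≤ s ^ 2 / 8 := by nlinarith [sq_nonneg (s - 4)]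
    have h4 : 2 - s ≤ s ^ 2 / 8 := by nlinarith
    nlinarith [mul_nonneg (sub_nonneg.2 h3) (sub_nonneg.2 h4)]

lemma majConst_add_majExp_le_sq {s : ℝ} (hs : -1 ≤ s) : majConst s + majExp s ≤ 2 * s ^ 2 := by
  unfold majConst majExp
  split_ifs with h1 h2
  · have := abs_le.1 (Real.abs_exp_sub_one_sub_id_le (x := -s)
      (abs_le.2 ⟨by linarith, by linarith⟩))
    nlinarith [this.2]
  · nlinarith [sq_nonneg s]
  · have : Real.exp (-s) ≤ 1 := Real.exp_le_one_iff.2 (by linarith)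
    nlinarith

lemma posConst_add_posExp_le_linear (s : ℝ) :
    posConst s + posExp s ≤ 2 * s ^ 2 - 3 / 2 * s + 9 / 16 := by
  unfold posConst posExp
  split_ifs with h1 h2
  · nlinarith
  · nlinarith [sq_nonneg (s - 3 / 4)]
  · nlinarith

lemma posConst_add_posExp_le_sq {s : ℝ} (hs : s ≤ 2) : posConst s + posExp s ≤ s ^ 2 := by
  unfold posConst posExp
  split_ifs with h1
  · nlinarith
  · nlinarith

lemma posConst_add_posExp_nonpos {s : ℝ} (hs : s ≤ 0) : posConst s + posExp s ≤ 0 := by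
  unfold posConst posExp
  split_ifs with h1 h2
  · norm_num
  · have : s = 0 := by linarith
    subst this; norm_num
  · linarith

/-- Growth condition making a sequence summable against Poisson weights. -/
def Growth (C s x : ℝ) : Prop := |x| ≤ C * (1 + s ^ 2 + Real.exp (-s))

lemma growth_majExp (s : ℝ) : Growth 8 s (majExp s) := by
  have := Real.exp_pos (-s)
  unfold Growth majExp
  split_ifs with h1 h2 <;> rw [abs_le] <;> constructor <;>
    nlinarith [sq_nonneg (s + 1), sq_nonneg (s - 1)]

lemma growth_majConst (s : ℝ) : Growth 8 s (majConst s) := by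
  have := Real.exp_pos (-s)
  unfold Growth majConst
  split_ifs with h1 h2 <;> rw [abs_le] <;> constructor <;>
    nlinarith [sq_nonneg (s + 1), sq_nonneg (s - 1)]

lemma growth_posExp (s : ℝ) : Growth 8 s (posExp s) := by
  have := Real.exp_pos (-s)
  unfold Growth posExp
  split_ifs with h1 h2 <;> rw [abs_le] <;> constructor <;>
    nlinarith [sq_nonneg (s + 1), sq_nonneg (s - 1)]

lemma growth_posConst (s : ℝ) : Growth 8 s (posConst s) := by
  have := Real.exp_pos (-s)
  unfold Growth posConst
  split_ifs with h1 h2 <;> rw [abs_le] <;> constructor <;>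
    nlinarith [sq_nonneg (s + 1), sq_nonneg (s - 1)]

/-- The affine function of `exp (-L)` tangent to a convex majorant of `L ^ 2`. -/
lemma exists_tangent_convexMajorant (U : ℝ) : ∃ α β : ℝ, U ^ 2 ≤ α + β * Real.exp (-U) ∧
    β ≤ 2 ∧ ∀ L, α + β * Real.exp (-L) ≤ convexMajorant L := by
  have hle : ∀ L, (max L 0) ^ 2 ≤ convexMajorant L := fun L => by
    unfold convexMajorant
    split_ifs with h
    · rw [max_eq_right h.le]; nlinarith [Real.add_one_le_exp (-L)]
    · rw [max_eq_left (not_lt.1 h)]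
  have hle' : ∀ L, 2 * (Real.exp (-L) - 1 + L) ≤ convexMajorant L := fun L => by
    unfold convexMajorant
    split_ifs with h
    · rfl
    · nlinarith [exp_neg_sub_le (not_lt.1 h)]
  have hU1 : Real.exp U * Real.exp (-U) = 1 := by rw [← Real.exp_add]; simp
  rcases le_or_gt 0 U with hU | hU
  · refine ⟨U ^ 2 + 2 * U, -(2 * U * Real.exp U), ?_, ?_, fun L => ?_⟩
    · nlinarith
    · nlinarith [mul_nonneg hU (Real.exp_pos U).le]
    · linarith [tangent_posPart_sq (L := L) hU, hle L]
  · refine ⟨2 * U, 2 * (1 - Real.exp U), ?_, ?_, fun L => ?_⟩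
    · nlinarith [Real.quadratic_le_exp_of_nonneg (show 0 ≤ -U by linarith)]
    · linarith [Real.exp_pos U]
    · linarith [tangent_exp U L, hle' L]

lemma exists_tangent_posPart {U : ℝ} (hU : 0 ≤ U) : ∃ α β : ℝ, U ^ 2 ≤ α + β * Real.exp (-U) ∧
    β ≤ 0 ∧ ∀ L, α + β * Real.exp (-L) ≤ (max L 0) ^ 2 := by
  have hU1 : Real.exp U * Real.exp (-U) = 1 := by rw [← Real.exp_add]; simp
  refine ⟨U ^ 2 + 2 * U, -(2 * U * Real.exp U), ?_, ?_, fun L => ?_⟩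
  · nlinarith
  · nlinarith [mul_nonneg hU (Real.exp_pos U).le]
  · linarith [tangent_posPart_sq (L := L) hU]

/-- The Poisson weights. -/
def poisWeight (l : ℝ) (n : ℕ) : ℝ := Real.exp (-l) * l ^ n / (Nat.factorial n : ℝ)

lemma poisWeight_pos {l : ℝ} (hl : 0 < l) (n : ℕ) : 0 < poisWeight l n := by
  unfold poisWeight; positivity

lemma hasSum_poisWeight_pow (l r : ℝ) :
    HasSum (fun n => poisWeight l n * r ^ n) (Real.exp (-l) * Real.exp (l * r)) := by
  have h := (NormedSpace.expSeries_div_hasSum_exp (l * r)).mul_left (Real.exp (-l))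
  rw [← Real.exp_eq_exp_ℝ] at h
  refine h.congr_fun fun n => ?_
  unfold poisWeight; rw [mul_pow]; ring

lemma hasSum_poisWeight (l : ℝ) : HasSum (poisWeight l) 1 := by
  have h := hasSum_poisWeight_pow l 1
  simpa [← Real.exp_add] using h

lemma hasSum_poisWeight_descFactorial (l : ℝ) (k : ℕ) :
    HasSum (fun n => poisWeight l n * (n.descFactorial k : ℝ)) (l ^ k) := by
  rw [← hasSum_nat_add_iff' k, Finset.sum_eq_zero, sub_zero]
  · have h := (hasSum_poisWeight l).mul_left (l ^ k)
    rw [mul_one] at h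
    refine h.congr_fun fun n => ?_
    have h1 : ((n + k).factorial : ℝ) = n.factorial * (n + k).descFactorial k := by
      rw [← Nat.cast_mul, Nat.factorial_mul_descFactorial (Nat.le_add_left k n) |>.symm]
      simp
    have h2 : ((n + k).descFactorial k : ℝ) ≠ 0 := by
      have : 0 < (n + k).descFactorial k := Nat.descFactorial_pos.2 (Nat.le_add_left k n)
      positivity
    unfold poisWeight
    rw [h1]
    field_simp
    ring
  · intro i hi
    rw [Nat.descFactorial_of_lt (Finset.mem_range.1 hi)]; simp

lemma cast_descFactorial_succ (n k : ℕ) :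
    (n.descFactorial (k + 1) : ℝ) = ((n : ℝ) - k) * n.descFactorial k := by
  rw [Nat.descFactorial_succ]
  rcases le_or_gt k n with h | h
  · push_cast [h]; ring
  · rw [Nat.descFactorial_of_lt h]; simp

lemma hasSum_poisWeight_linear (l y r : ℝ) :
    HasSum (fun n => poisWeight l n * (y - n * r)) (y - l * r) := by
  have h := ((hasSum_poisWeight l).mul_left y).sub
    ((hasSum_poisWeight_descFactorial l 1).mul_left r)
  convert h.congr_fun fun n => ?_ using 1
  · rfl
  · ring
  · simp; ring

lemma hasSum_poisWeight_sq (l y r : ℝ) :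
    HasSum (fun n => poisWeight l n * (y - n * r) ^ 2) ((y - l * r) ^ 2 + l * r ^ 2) := by
  have h := (((hasSum_poisWeight l).mul_left (y ^ 2)).add
    ((hasSum_poisWeight_descFactorial l 1).mul_left (r ^ 2 - 2 * y * r))).add
    ((hasSum_poisWeight_descFactorial l 2).mul_left (r ^ 2))
  convert h.congr_fun fun n => ?_ using 1
  · rfl
  · ring
  · simp only [cast_descFactorial_succ, Nat.descFactorial_zero]; push_cast; ring

lemma hasSum_poisWeight_quartic (l y r : ℝ) :
    HasSum (fun n => poisWeight l n * (y - n * r) ^ 4)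
      ((y - l * r) ^ 4 + 6 * (y - l * r) ^ 2 * (l * r ^ 2) - 4 * (y - l * r) * (l * r ^ 3)
        + 3 * (l * r ^ 2) ^ 2 + l * r ^ 4) := by
  have h := (((((hasSum_poisWeight l).mul_left (y ^ 4)).add
    ((hasSum_poisWeight_descFactorial l 1).mul_left
      (r ^ 4 - 4 * y * r ^ 3 + 6 * y ^ 2 * r ^ 2 - 4 * y ^ 3 * r))).add
    ((hasSum_poisWeight_descFactorial l 2).mul_left
      (7 * r ^ 4 - 12 * y * r ^ 3 + 6 * y ^ 2 * r ^ 2))).add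
    ((hasSum_poisWeight_descFactorial l 3).mul_left (6 * r ^ 4 - 4 * y * r ^ 3))).add
    ((hasSum_poisWeight_descFactorial l 4).mul_left (r ^ 4))
  convert h.congr_fun fun n => ?_ using 1
  · rfl
  · ring
  · simp only [cast_descFactorial_succ, Nat.descFactorial_zero]; push_cast; ring

lemma IsPMF.hasSum {p : ℕ → ℝ} (hp : IsPMF p) : HasSum p 1 := by
  have : Summable p := by
    by_contra h
    have := hp.2
    rw [tsum_eq_zero_of_not_summable h] at this
    norm_num at this
  exact hp.2 ▸ this.hasSum

lemma conv_nonneg {a b : ℕ → ℝ} (ha : ∀ i, 0 ≤ a i) (hb : ∀ i, 0 ≤ b i) (i : ℕ) :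
    0 ≤ conv a b i :=
  Finset.sum_nonneg fun k _ => mul_nonneg (ha k) (hb _)

lemma hasSum_conv {a b : ℕ → ℝ} {x y : ℝ} (ha : ∀ i, 0 ≤ a i) (hb : ∀ i, 0 ≤ b i)
    (hax : HasSum a x) (hby : HasSum b y) : HasSum (conv a b) (x * y) := by
  have hna : Summable fun i => ‖a i‖ := by
    simpa [Real.norm_eq_abs, abs_of_nonneg (ha _)] using hax.summable
  have hnb : Summable fun i => ‖b i‖ := by
    simpa [Real.norm_eq_abs, abs_of_nonneg (hb _)] using hby.summable
  have h1 : Summable (conv a b) :=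
    (summable_norm_sum_mul_range_of_summable_norm hna hnb).of_norm
  have h2 := tsum_mul_tsum_eq_tsum_sum_range_of_summable_norm hna hnb
  rw [hax.tsum_eq, hby.tsum_eq] at h2
  rw [h2]; exact h1.hasSum

lemma convPow_nonneg {p : ℕ → ℝ} (hp : IsPMF p) (n i : ℕ) : 0 ≤ convPow p n i := by
  induction n generalizing i with
  | zero => unfold convPow delta0; split_ifs <;> norm_num
  | succ n ih => exact conv_nonneg ih hp.1 i

lemma hasSum_convPow {p : ℕ → ℝ} (hp : IsPMF p) (n : ℕ) : HasSum (convPow p n) 1 := by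
  induction n with
  | zero => exact hasSum_ite_eq 0 1
  | succ n ih =>
    have h := hasSum_conv (convPow_nonneg hp n) hp.1 ih hp.hasSum
    rwa [one_mul] at h

lemma convPow_le_one {p : ℕ → ℝ} (hp : IsPMF p) (n i : ℕ) : convPow p n i ≤ 1 :=
  le_hasSum (hasSum_convPow hp n) i fun j _ => convPow_nonneg hp n j

lemma convPow_pos_of_pos {p p' : ℕ → ℝ} (hp : IsPMF p) (hp' : IsPMF p')
    (habs : ∀ i, 0 < p i → 0 < p' i) (n i : ℕ) (h : 0 < convPow p n i) :
    0 < convPow p' n i := by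
  induction n generalizing i with
  | zero => exact h
  | succ n ih =>
    change 0 < ∑ k ∈ Finset.range (i + 1), convPow p n k * p (i - k) at h
    obtain ⟨k, hk, hk'⟩ := Finset.exists_ne_zero_of_sum_ne_zero h.ne'
    have h1 : 0 < convPow p n k :=
      (convPow_nonneg hp n k).lt_of_ne' (left_ne_zero_of_mul hk')
    have h2 : 0 < p (i - k) := (hp.1 _).lt_of_ne' (right_ne_zero_of_mul hk')
    exact Finset.sum_pos' (fun j _ => mul_nonneg (convPow_nonneg hp' n j) (hp'.1 _))
      ⟨k, hk, mul_pos (ih k h1) (habs _ h2)⟩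

lemma convPow_apply_zero {p : ℕ → ℝ} (h0 : p 0 = 0) {n : ℕ} (hn : n ≠ 0) :
    convPow p n 0 = 0 := by
  obtain ⟨m, rfl⟩ := Nat.exists_eq_succ_of_ne_zero hn
  simp [convPow, conv, h0]

lemma convPow_one (p : ℕ → ℝ) : convPow p 1 = p := by
  ext i
  simp only [convPow, conv, delta0]
  rw [Finset.sum_eq_single 0] <;> simp +contextual

/-- The term of the V divergence of a convolution is controlled by those of the factors. -/
lemma conv_logSq_le {a a' b b' : ℕ → ℝ} (ha : ∀ i, 0 ≤ a i) (hb : ∀ i, 0 ≤ b i)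
    (ha' : ∀ i, 0 ≤ a' i) (hb' : ∀ i, 0 ≤ b' i) (haa : ∀ i, 0 < a i → 0 < a' i)
    (hbb : ∀ i, 0 < b i → 0 < b' i) (i : ℕ) :
    conv a b i * Real.log (conv a b i / conv a' b' i) ^ 2 ≤
      4 * conv (fun k => a k * Real.log (a k / a' k) ^ 2) b i +
      4 * conv a (fun k => b k * Real.log (b k / b' k) ^ 2) i + 2 * conv a' b' i := by
  have hR : 0 ≤ 4 * conv (fun k => a k * Real.log (a k / a' k) ^ 2) b i +
      4 * conv a (fun k => b k * Real.log (b k / b' k) ^ 2) i + 2 * conv a' b' i := by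
    have h1 := conv_nonneg (a := fun k => a k * Real.log (a k / a' k) ^ 2)
      (fun k => mul_nonneg (ha k) (sq_nonneg _)) hb i
    have h2 := conv_nonneg (b := fun k => b k * Real.log (b k / b' k) ^ 2) ha
      (fun k => mul_nonneg (hb k) (sq_nonneg _)) i
    have h3 := conv_nonneg ha' hb' i
    positivity
  rcases (conv_nonneg ha hb i).eq_or_lt with h0 | hpos
  · rw [← h0, zero_mul]; exact hR
  have hpos' : 0 < conv a' b' i := by
    obtain ⟨k, hk, hk'⟩ := Finset.exists_ne_zero_of_sum_ne_zero hpos.ne'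
    exact Finset.sum_pos' (fun j _ => mul_nonneg (ha' j) (hb' _))
      ⟨k, hk, mul_pos (haa _ ((ha k).lt_of_ne' (left_ne_zero_of_mul hk')))
        (hbb _ ((hb _).lt_of_ne' (right_ne_zero_of_mul hk')))⟩
  set U := Real.log (conv a b i / conv a' b' i) with hU
  have hexp : Real.exp (-U) = conv a' b' i / conv a b i := by
    rw [hU, Real.exp_neg, Real.exp_log (div_pos hpos hpos'), inv_div]
  obtain ⟨α, β, h1, h2, h3⟩ := exists_tangent_convexMajorant U
  have h4 : conv a b i * U ^ 2 ≤ α * conv a b i + β * conv a' b' i := by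
    calc _ ≤ conv a b i * (α + β * Real.exp (-U)) := mul_le_mul_of_nonneg_left h1 hpos.le
      _ = _ := by rw [hexp]; field_simp
  refine h4.trans ?_
  simp only [conv, Finset.mul_sum, ← Finset.sum_add_distrib]
  refine Finset.sum_le_sum fun k _ => ?_
  rcases (mul_nonneg (ha k) (hb (i - k))).eq_or_lt with h5 | h5
  · have h6 := mul_nonneg (ha' k) (hb' (i - k))
    have h7 : 4 * (a k * Real.log (a k / a' k) ^ 2 * b (i - k)) = 0 := by
      rw [mul_right_comm, ← h5]; ring
    have h8 : 4 * (a k * (b (i - k) * Real.log (b (i - k) / b' (i - k)) ^ 2)) = 0 := by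
      rw [← mul_assoc (a k), ← h5]; ring
    rw [h7, h8, ← h5]
    nlinarith
  · have hak : 0 < a k := (ha k).lt_of_ne' (left_ne_zero_of_mul h5.ne')
    have hbk : 0 < b (i - k) := (hb _).lt_of_ne' (right_ne_zero_of_mul h5.ne')
    have hak' := haa _ hak
    have hbk' := hbb _ hbk
    set t := Real.log (a k / a' k)
    set u := Real.log (b (i - k) / b' (i - k))
    have ht : a' k = a k * Real.exp (-t) := by
      rw [Real.exp_neg, Real.exp_log (by positivity)]; field_simp
    have hu : b' (i - k) = b (i - k) * Real.exp (-u) := by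
      rw [Real.exp_neg, Real.exp_log (by positivity)]; field_simp
    have hm : Real.exp (-(t + u)) = Real.exp (-t) * Real.exp (-u) := by
      rw [← Real.exp_add]; ring_nf
    have h6 : convexMajorant (t + u) ≤ 4 * t ^ 2 + 4 * u ^ 2 + 2 * Real.exp (-(t + u)) := by
      have := Real.exp_pos (-(t + u))
      unfold convexMajorant
      split_ifs <;> nlinarith [sq_nonneg (t - u), sq_nonneg t, sq_nonneg u]
    have h7 := mul_le_mul_of_nonneg_left ((h3 (t + u)).trans h6) h5.le
    rw [ht, hu]
    rw [hm] at h7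
    linarith

lemma Vd_convPow_le {p p' : ℕ → ℝ} (hp : IsPMF p) (hp' : IsPMF p')
    (habs : ∀ i, 0 < p i → 0 < p' i)
    (hV : ∀ n : ℕ, Summable fun i =>
      convPow p n i * (Real.log (convPow p n i / convPow p' n i)) ^ 2) (n : ℕ) :
    Vd (convPow p n) (convPow p' n) ≤ 5 ^ n * (4 * Vd p p' + 2) := by
  have hV1 : Summable fun i => p i * Real.log (p i / p' i) ^ 2 := by
    simpa only [convPow_one] using hV 1
  have h0 : 0 ≤ Vd p p' := tsum_nonneg fun i => mul_nonneg (hp.1 i) (sq_nonneg _)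
  induction n with
  | zero =>
    have : Vd (convPow p 0) (convPow p' 0) = 0 := by
      unfold Vd convPow
      refine (tsum_congr fun i => ?_).trans tsum_zero
      unfold delta0; split_ifs <;> simp
    rw [this]; positivity
  | succ n ih =>
    have hP := convPow_nonneg hp n
    have hP' := convPow_nonneg hp' n
    have hs1 := hasSum_conv (fun k => mul_nonneg (hP k) (sq_nonneg _)) hp.1 (hV n).hasSum hp.hasSum
    have hs2 := hasSum_conv hP (fun k => mul_nonneg (hp.1 k) (sq_nonneg _))
      (hasSum_convPow hp n) hV1.hasSum
    have hs3 := hasSum_convPow hp' (n + 1)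
    have hs := ((hs1.mul_left 4).add (hs2.mul_left 4)).add (hs3.mul_left 2)
    have hle := hasSum_le (conv_logSq_le hP hp.1 hP' hp'.1 (convPow_pos_of_pos hp hp' habs n) habs)
      (hV (n + 1)).hasSum hs
    have h5 : (1 : ℝ) ≤ 5 ^ n := one_le_pow₀ (by norm_num)
    change Vd _ _ ≤ 4 * (Vd (convPow p n) (convPow p' n) * 1) + 4 * (1 * Vd p p') + 2 * 1 at hle
    rw [pow_succ]
    nlinarith

/-- The logarithm of the ratio of two Poisson mass functions at `n`. -/
def poisLog (l l' : ℝ) (n : ℕ) : ℝ := (l' - l) - n * Real.log (l' / l)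

lemma poisWeight_mul_exp_neg_poisLog {l l' : ℝ} (hl : 0 < l) (hl' : 0 < l') (n : ℕ) :
    poisWeight l n * Real.exp (-poisLog l l' n) = poisWeight l' n := by
  have h : Real.exp (-poisLog l l' n) = Real.exp (-l') * Real.exp l * (l' / l) ^ n := by
    rw [← Real.exp_log (div_pos hl' hl), ← Real.exp_nat_mul, ← Real.exp_add, ← Real.exp_add]
    congr 1; unfold poisLog; ring
  rw [h]
  have h1 : Real.exp (-l) * Real.exp l = 1 := by rw [← Real.exp_add]; simp
  unfold poisWeight
  rw [div_pow]
  field_simp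
  linear_combination h1

lemma log_poisWeight_ratio {l l' : ℝ} (hl : 0 < l) (hl' : 0 < l') (n : ℕ) :
    Real.log ((Real.exp (-l) * l ^ n) / (Real.exp (-l') * l' ^ n)) = poisLog l l' n := by
  rw [Real.log_div (by positivity) (by positivity), Real.log_mul (by positivity) (by positivity),
    Real.log_mul (by positivity) (by positivity), Real.log_pow, Real.log_pow, Real.log_exp,
    Real.log_exp, poisLog, Real.log_div hl'.ne' hl.ne']
  ring

lemma hasSum_poisWeight_exp_neg_poisLog {l l' : ℝ} (hl : 0 < l) (hl' : 0 < l') :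
    HasSum (fun n => poisWeight l n * Real.exp (-poisLog l l' n)) 1 := by
  simpa only [poisWeight_mul_exp_neg_poisLog hl hl'] using hasSum_poisWeight l'

lemma summable_poisWeight_abs_of_growth {l l' : ℝ} (hl : 0 < l) (hl' : 0 < l') {C : ℝ}
    {a : ℕ → ℝ} (ha : ∀ n, Growth C (poisLog l l' n) (a n)) :
    Summable fun n => poisWeight l n * |a n| := by
  have h := (((hasSum_poisWeight l).add
    (hasSum_poisWeight_sq l (l' - l) (Real.log (l' / l)))).add
    (hasSum_poisWeight_exp_neg_poisLog hl hl')).summable.mul_left C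
  refine Summable.of_nonneg_of_le (fun n => mul_nonneg (poisWeight_pos hl n).le (abs_nonneg _))
    (fun n => ?_) h
  have := mul_le_mul_of_nonneg_left (ha n) (poisWeight_pos hl n).le
  refine this.trans_eq ?_
  unfold poisLog; ring

lemma summable_poisWeight_of_growth {l l' : ℝ} (hl : 0 < l) (hl' : 0 < l') {C : ℝ}
    {a : ℕ → ℝ} (ha : ∀ n, Growth C (poisLog l l' n) (a n)) :
    Summable fun n => poisWeight l n * a n :=
  Summable.of_norm_bounded (summable_poisWeight_abs_of_growth hl hl' ha) fun n => by
    rw [Real.norm_eq_abs, abs_mul, abs_of_pos (poisWeight_pos hl n)]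

lemma summable_poisWeight_Vd {l : ℝ} (hl : 0 < l) {p p' : ℕ → ℝ} (hp : IsPMF p) (hp' : IsPMF p')
    (habs : ∀ i, 0 < p i → 0 < p' i)
    (hV : ∀ n : ℕ, Summable fun i =>
      convPow p n i * (Real.log (convPow p n i / convPow p' n i)) ^ 2) :
    Summable fun n => poisWeight l n * Vd (convPow p n) (convPow p' n) := by
  refine Summable.of_nonneg_of_le (fun n => mul_nonneg (poisWeight_pos hl n).le
    (tsum_nonneg fun i => mul_nonneg (convPow_nonneg hp n i) (sq_nonneg _))) (fun n => ?_)
    ((hasSum_poisWeight_pow l 5).summable.mul_right (4 * Vd p p' + 2))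
  rw [mul_assoc]
  exact mul_le_mul_of_nonneg_left (Vd_convPow_le hp hp' habs hV n) (poisWeight_pos hl n).le

lemma tsum_le_tsum_tsum_of_le {G : ℕ → ℝ} {R : ℕ → ℕ → ℝ} (hR : Summable (Function.uncurry R))
    (h0 : ∀ i, 0 ≤ G i) (hG : ∀ i, G i ≤ ∑' n, R n i) : ∑' i, G i ≤ ∑' n, ∑' i, R n i := by
  have hs : Summable fun i => ∑' n, R n i := hR.prod_symm.prod
  rw [← hR.tsum_comm]
  exact Summable.tsum_le_tsum hG (Summable.of_nonneg_of_le h0 hG hs) hs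

lemma summable_poisWeight_mul_convPow {l : ℝ} (hl : 0 < l) {p : ℕ → ℝ} (hp : IsPMF p) (i : ℕ) :
    Summable fun n => poisWeight l n * convPow p n i :=
  Summable.of_nonneg_of_le (fun n => mul_nonneg (poisWeight_pos hl n).le (convPow_nonneg hp n i))
    (fun n => mul_le_of_le_one_right (poisWeight_pos hl n).le (convPow_le_one hp n i))
    (hasSum_poisWeight l).summable

/-- The majorant of the contribution of `n` summands at `i`. -/
def logSqMajorant (P P' e f : ℝ) : ℝ :=
  2 * (P * Real.log (P / P') ^ 2) + 4 * (P * Real.log (P / P')) + e * P + f * P'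

lemma abs_logSqMajorant_le {P P' e f : ℝ} (hP : 0 ≤ P) (hP' : 0 ≤ P') :
    |logSqMajorant P P' e f| ≤ 6 * (P * Real.log (P / P') ^ 2) + (4 + |e|) * P + |f| * P' := by
  unfold logSqMajorant
  set t := Real.log (P / P')
  have h1 : |P * t| ≤ P + P * t ^ 2 := by
    rw [abs_mul, abs_of_nonneg hP, ← sq_abs t]
    nlinarith [mul_nonneg hP (sq_nonneg (|t| - 1 / 2))]
  have h2 := neg_abs_le (P * t)
  have h3 := le_abs_self (P * t)
  have h4 := mul_le_mul_of_nonneg_right (neg_abs_le e) hP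
  have h5 := mul_le_mul_of_nonneg_right (le_abs_self e) hP
  have h6 := mul_le_mul_of_nonneg_right (neg_abs_le f) hP'
  have h7 := mul_le_mul_of_nonneg_right (le_abs_self f) hP'
  have h8 : 0 ≤ P * t ^ 2 := by positivity
  rw [abs_le]
  constructor <;> nlinarith

lemma le_logSqMajorant {P P' e f s α β : ℝ} (hP : 0 ≤ P) (hP' : 0 ≤ P') (hPP : 0 < P → 0 < P')
    (h1 : ∀ t, α + β * Real.exp (-(s + t)) ≤ 2 * t ^ 2 + 4 * t + e + f * Real.exp (-t))
    (h2 : β * Real.exp (-s) ≤ f) :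
    α * P + β * (Real.exp (-s) * P') ≤ logSqMajorant P P' e f := by
  unfold logSqMajorant
  rcases hP.eq_or_lt with h | h
  · rw [← h]
    nlinarith [mul_le_mul_of_nonneg_right h2 hP']
  · have hP'0 := hPP h
    set t := Real.log (P / P')
    have ht : P' = P * Real.exp (-t) := by
      rw [Real.exp_neg, Real.exp_log (by positivity)]; field_simp
    have h3 := mul_le_mul_of_nonneg_left (h1 t) h.le
    rw [neg_add, Real.exp_add] at h3
    rw [ht]
    linarith

/-- Comparison of the `V` divergence of compound Poisson distributions with a mixture, from a
family of affine majorants in `exp (-U)`. -/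
lemma Vd_cpq_le_of_majorant {lam lam' : ℝ} (hl : 0 < lam) (hl' : 0 < lam')
    {p p' : ℕ → ℝ} (hp : IsPMF p) (hp' : IsPMF p') (h0 : p 0 = 0) (h0' : p' 0 = 0)
    (habs : ∀ i, 0 < p i → 0 < p' i)
    (hKL : ∀ n : ℕ, Summable fun i =>
      convPow p n i * Real.log (convPow p n i / convPow p' n i))
    (hV : ∀ n : ℕ, Summable fun i =>
      convPow p n i * (Real.log (convPow p n i / convPow p' n i)) ^ 2)
    {e f : ℕ → ℝ} {C : ℝ} (hf : ∀ n, 0 ≤ f n) (hCe : ∀ n, Growth C (poisLog lam lam' n) (e n))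
    (hCf : ∀ n, Growth C (poisLog lam lam' n) (f n))
    (hmain : ∀ U : ℝ, ∃ α β : ℝ, U ^ 2 ≤ α + β * Real.exp (-U) ∧
      ∀ n, (n ≠ 0 ∨ U = poisLog lam lam' 0) →
        (∀ t, α + β * Real.exp (-(poisLog lam lam' n + t)) ≤
          2 * t ^ 2 + 4 * t + e n + f n * Real.exp (-t)) ∧
        β * Real.exp (-poisLog lam lam' n) ≤ f n) :
    Vd (cpq lam p) (cpq lam' p') ≤
      2 * (∑' n : ℕ, poisWeight lam n *
        (Vd (convPow p n) (convPow p' n) + 2 * KL (convPow p n) (convPow p' n))) +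
      ∑' n, poisWeight lam n * (e n + f n) := by
  have hw := fun n => poisWeight_pos hl n
  have hP := fun n => convPow_nonneg hp n
  have hP' := fun n => convPow_nonneg hp' n
  have hVs := summable_poisWeight_Vd hl hp hp' habs hV
  have hpos := convPow_pos_of_pos hp hp' habs
  set R : ℕ → ℕ → ℝ := fun n i =>
    poisWeight lam n * logSqMajorant (convPow p n i) (convPow p' n i) (e n) (f n) with hRdef
  have hRi : ∀ n, HasSum (R n) (poisWeight lam n * (2 * Vd (convPow p n) (convPow p' n)
      + 4 * KL (convPow p n) (convPow p' n) + e n * 1 + f n * 1)) := fun n =>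
    (((((hV n).hasSum.mul_left 2).add ((hKL n).hasSum.mul_left 4)).add
      ((hasSum_convPow hp n).mul_left (e n))).add
      ((hasSum_convPow hp' n).mul_left (f n))).mul_left _
  have hD : Summable (Function.uncurry R) := by
    have hDi : ∀ n, HasSum (fun i => poisWeight lam n *
        (6 * (convPow p n i * Real.log (convPow p n i / convPow p' n i) ^ 2) +
          (4 + |e n|) * convPow p n i + |f n| * convPow p' n i))
        (poisWeight lam n * (6 * Vd (convPow p n) (convPow p' n) + (4 + |e n|) * 1 + |f n| * 1)) :=
      fun n => ((((hV n).hasSum.mul_left 6).add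
        ((hasSum_convPow hp n).mul_left (4 + |e n|))).add
        ((hasSum_convPow hp' n).mul_left (|f n|))).mul_left _
    have hsum : Summable fun x : ℕ × ℕ => poisWeight lam x.1 *
        (6 * (convPow p x.1 x.2 * Real.log (convPow p x.1 x.2 / convPow p' x.1 x.2) ^ 2) +
          (4 + |e x.1|) * convPow p x.1 x.2 + |f x.1| * convPow p' x.1 x.2) := by
      refine (summable_prod_of_nonneg fun x => ?_).2 ⟨fun n => (hDi n).summable, ?_⟩
      · have h1 := hP x.1 x.2
        have h2 := hP' x.1 x.2
        have h3 := (hw x.1).le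
        simp only [Pi.zero_apply]
        positivity
      · simp only [(hDi _).tsum_eq]
        refine ((((hVs.mul_left 6).add ((hasSum_poisWeight lam).summable.mul_left 4)).add
          (summable_poisWeight_abs_of_growth hl hl' hCe)).add
          (summable_poisWeight_abs_of_growth hl hl' hCf)).congr fun n => ?_
        ring
    refine Summable.of_norm_bounded hsum fun x => ?_
    rw [Real.norm_eq_abs, Function.uncurry, abs_mul, abs_of_pos (hw x.1)]
    exact mul_le_mul_of_nonneg_left (abs_logSqMajorant_le (hP _ _) (hP' _ _)) (hw x.1).le
  have hq0 : ∀ i, 0 ≤ cpq lam p i := fun i => tsum_nonneg fun n => mul_nonneg (hw n).le (hP n i)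
  have hpoint : ∀ i, cpq lam p i * Real.log (cpq lam p i / cpq lam' p' i) ^ 2 ≤ ∑' n, R n i := by
    intro i
    have hsR : Summable fun n => R n i := hD.prod_symm.prod_factor i
    have hq : HasSum (fun n => poisWeight lam n * convPow p n i) (cpq lam p i) :=
      (summable_poisWeight_mul_convPow hl hp i).hasSum
    have hq' : HasSum (fun n => poisWeight lam' n * convPow p' n i) (cpq lam' p' i) :=
      (summable_poisWeight_mul_convPow hl' hp' i).hasSum
    rcases (hq0 i).eq_or_lt with hz | hqpos
    · rw [← hz, zero_mul]
      rw [← hz, hasSum_zero_iff_of_nonneg fun n => mul_nonneg (hw n).le (hP n i)] at hq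
      refine tsum_nonneg fun n => mul_nonneg (hw n).le ?_
      have h1 : convPow p n i = 0 :=
        (mul_eq_zero.1 (congrFun hq n)).resolve_left (hw n).ne'
      rw [logSqMajorant, h1]
      have := mul_nonneg (hf n) (hP' n i)
      linarith
    have hqpos' : 0 < cpq lam' p' i := by
      have hex : ∃ n, 0 < convPow p n i := by
        by_contra! hc
        refine hqpos.ne' (hq.unique ?_)
        refine hasSum_zero.congr_fun fun n => ?_
        rw [le_antisymm (hc n) (hP n i), mul_zero]
      obtain ⟨n, hn⟩ := hex
      exact (mul_pos (poisWeight_pos hl' n) (hpos n i hn)).trans_le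
        (le_hasSum hq' n fun m _ => mul_nonneg (poisWeight_pos hl' m).le (hP' m i))
    set U := Real.log (cpq lam p i / cpq lam' p' i) with hU
    have hexp : Real.exp (-U) = cpq lam' p' i / cpq lam p i := by
      rw [hU, Real.exp_neg, Real.exp_log (div_pos hqpos hqpos'), inv_div]
    obtain ⟨α, β, h1, h2⟩ := hmain U
    have h3 : cpq lam p i * U ^ 2 ≤ α * cpq lam p i + β * cpq lam' p' i := by
      calc _ ≤ cpq lam p i * (α + β * Real.exp (-U)) := mul_le_mul_of_nonneg_left h1 hqpos.le
        _ = _ := by rw [hexp]; field_simp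
    refine h3.trans (hasSum_le (fun n => ?_) ((hq.mul_left α).add (hq'.mul_left β)) hsR.hasSum)
    by_cases hn : (n ≠ 0 ∨ U = poisLog lam lam' 0)
    · obtain ⟨h4, h5⟩ := h2 n hn
      have h6 := mul_le_mul_of_nonneg_left
        (le_logSqMajorant (hP n i) (hP' n i) (hpos n i) h4 h5) (hw n).le
      rw [← poisWeight_mul_exp_neg_poisLog hl hl']
      refine le_trans (le_of_eq ?_) h6
      ring
    · push Not at hn
      obtain ⟨rfl, hn⟩ := hn
      have hi : i ≠ 0 := by
        rintro rfl
        have hq1 : cpq lam p 0 = poisWeight lam 0 := hq.unique <| by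
          convert hasSum_single (f := fun n => poisWeight lam n * convPow p n 0) 0
            fun n hn => by rw [convPow_apply_zero h0 hn, mul_zero] using 1
          simp [convPow, delta0]
        have hq1' : cpq lam' p' 0 = poisWeight lam' 0 := hq'.unique <| by
          convert hasSum_single (f := fun n => poisWeight lam' n * convPow p' n 0) 0
            fun n hn => by rw [convPow_apply_zero h0' hn, mul_zero] using 1
          simp [convPow, delta0]
        apply hn
        rw [hU, hq1, hq1', ← log_poisWeight_ratio hl hl']
        simp [poisWeight]
      simp [hRdef, convPow, delta0, hi, logSqMajorant]
  refine (tsum_le_tsum_tsum_of_le hD (fun i => mul_nonneg (hq0 i) (sq_nonneg _)) hpoint).trans_eq ?_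
  have hKLs : Summable fun n => poisWeight lam n *
      (Vd (convPow p n) (convPow p' n) + 2 * KL (convPow p n) (convPow p' n)) := by
    have h1 := hD.prod
    simp only [Function.uncurry_apply_pair, (hRi _).tsum_eq] at h1
    refine (((h1.sub (summable_poisWeight_of_growth hl hl' hCe)).sub
      (summable_poisWeight_of_growth hl hl' hCf)).mul_left (1 / 2)).congr fun n => ?_
    ring
  have hef : Summable fun n => poisWeight lam n * (e n + f n) := by
    simpa only [mul_add] using (summable_poisWeight_of_growth hl hl' hCe).add
      (summable_poisWeight_of_growth hl hl' hCf)
  rw [← tsum_mul_left, ← (hKLs.mul_left 2).tsum_add hef]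
  refine tsum_congr fun n => ?_
  rw [(hRi n).tsum_eq]
  ring

/-- Existence of the majorants required by `Vd_cpq_le_of_majorant`. -/
def HasMajorant (l l' : ℝ) : Prop :=
  ∃ e f : ℕ → ℝ, ∃ C : ℝ, (∀ n, 0 ≤ f n) ∧ (∀ n, Growth C (poisLog l l' n) (e n)) ∧
    (∀ n, Growth C (poisLog l l' n) (f n)) ∧
    (∀ U : ℝ, ∃ α β : ℝ, U ^ 2 ≤ α + β * Real.exp (-U) ∧
      ∀ n, (n ≠ 0 ∨ U = poisLog l l' 0) →
        (∀ t, α + β * Real.exp (-(poisLog l l' n + t)) ≤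
          2 * t ^ 2 + 4 * t + e n + f n * Real.exp (-t)) ∧
        β * Real.exp (-poisLog l l' n) ≤ f n) ∧
    ∑' n, poisWeight l n * (e n + f n) ≤ 2 * ∑' n, poisWeight l n * poisLog l l' n ^ 2

lemma hasMajorant_of_convexMajorant {l l' : ℝ}
    (h : ∑' n, poisWeight l n * (majConst (poisLog l l' n) + majExp (poisLog l l' n)) ≤
      2 * ∑' n, poisWeight l n * poisLog l l' n ^ 2) : HasMajorant l l' := by
  refine ⟨_, _, 8, fun n => ?_, fun n => growth_majConst _, fun n => growth_majExp _,
    fun U => ?_, h⟩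
  · have := two_mul_exp_neg_le_majExp (poisLog l l' n)
    have := Real.exp_pos (-poisLog l l' n)
    linarith
  · obtain ⟨α, β, h1, h2, h3⟩ := exists_tangent_convexMajorant U
    refine ⟨α, β, h1, fun n _ => ⟨fun t => (h3 _).trans (convexMajorant_le _ t), ?_⟩⟩
    exact (mul_le_mul_of_nonneg_right h2 (Real.exp_pos _).le).trans (two_mul_exp_neg_le_majExp _)

lemma Growth.add_mul {C D D' s x a b : ℝ} (h : Growth C s x) (ha : |a| ≤ D) (hb : |b| ≤ D') :
    Growth (C + D + D') s (x + (a + b * Real.exp (-s))) := by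
  unfold Growth at *
  have h1 := abs_add_le x (a + b * Real.exp (-s))
  have h2 := abs_add_le a (b * Real.exp (-s))
  have hp := Real.exp_pos (-s)
  rw [abs_mul, abs_of_pos hp] at h2
  have h3 := mul_le_mul_of_nonneg_right hb hp.le
  have hD := (abs_nonneg a).trans ha
  have hD' := (abs_nonneg b).trans hb
  have h4 : 0 ≤ D * (s ^ 2 + Real.exp (-s)) := by positivity
  have h5 : 0 ≤ D' * (1 + s ^ 2) := by positivity
  linarith

lemma hasMajorant_of_posPart {l l' r a a' : ℝ} (hl : 0 < l) (hl' : 0 < l') (hr : 2 ≤ r)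
    {c : ℕ → ℝ} (hc0 : ∀ n, 0 ≤ c n) (hc1 : ∀ n, c n ≤ 1)
    (hc : ∀ n, (n ≠ 0 ∨ poisLog l l' 0 < 0) → c n = 1)
    (ha : HasSum (fun n => poisWeight l n * c n) a)
    (ha' : HasSum (fun n => poisWeight l' n * c n) a')
    (h : ∑' n, poisWeight l n * (posConst (poisLog l l' n) + posExp (poisLog l l' n)) +
      (r ^ 2 - 2 * r) * a + 2 * r * Real.exp (-r) * a' ≤
      2 * ∑' n, poisWeight l n * poisLog l l' n ^ 2) : HasMajorant l l' := by
  set s := poisLog l l' with hs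
  have hA : 0 ≤ r ^ 2 - 2 * r := by nlinarith
  set A := r ^ 2 - 2 * r with hAdef
  have hB : 0 ≤ 2 * r * Real.exp (-r) := by positivity
  set B := 2 * r * Real.exp (-r) with hBdef
  have hcb : ∀ n, |A * c n| ≤ A := fun n => by
    rw [abs_of_nonneg (mul_nonneg hA (hc0 n))]; exact mul_le_of_le_one_right hA (hc1 n)
  have hcb' : ∀ n, |B * c n| ≤ B := fun n => by
    rw [abs_of_nonneg (mul_nonneg hB (hc0 n))]; exact mul_le_of_le_one_right hB (hc1 n)
  have he0 := fun n => (Real.exp_pos (-s n)).le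
  have hge : ∀ n, Growth (8 + A + B) (s n) (posConst (s n) + A * c n) := fun n => by
    simpa using (growth_posConst (s n)).add_mul (hcb n) (b := 0) (by simpa using hB)
  have hgf : ∀ n, Growth (8 + A + B) (s n) (posExp (s n) + B * c n * Real.exp (-s n)) :=
    fun n => by
    simpa using (growth_posExp (s n)).add_mul (a := 0) (by simpa using hA) (hcb' n)
  refine ⟨_, _, _, fun n => ?_, hge, hgf, fun U => ?_, ?_⟩
  · have h1 := posExp_nonneg (s n)
    have h2 := hc0 n
    have h3 := he0 n
    positivity
  · have hadd : ∀ n t, Real.exp (-(s n + t)) = Real.exp (-s n) * Real.exp (-t) := fun n t => by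
      rw [neg_add, Real.exp_add]
    rcases le_or_gt 0 U with hU | hU
    · obtain ⟨α, β, h1, h2, h3⟩ := exists_tangent_posPart hU
      refine ⟨α, β, h1, fun n _ => ⟨fun t => ?_, ?_⟩⟩
      · have h4 := (h3 _).trans (posPart_sq_le (s n) t)
        have h5 := mul_nonneg hA (hc0 n)
        have h6 := mul_nonneg (mul_nonneg (mul_nonneg hB (hc0 n)) (he0 n)) (Real.exp_pos (-t)).le
        linarith
      · have h4 := mul_nonpos_of_nonpos_of_nonneg h2 (he0 n)
        have h5 := posExp_nonneg (s n)
        have h6 := mul_nonneg (mul_nonneg hB (hc0 n)) (he0 n)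
        linarith
    · refine ⟨A, B, ?_, fun n hn => ?_⟩
      · have := exp_pooled hr (u := -U) (by linarith)
        rwa [neg_sq] at this
      · have hcn : c n = 1 := hc n (hn.imp_right fun h : U = s 0 => by rwa [← h])
        refine ⟨fun t => ?_, ?_⟩
        · have h4 := (sq_nonneg _).trans (posPart_sq_le (s n) t)
          rw [hadd, hcn]
          linarith
        · have h5 := posExp_nonneg (s n)
          rw [hcn]; linarith
  · have h1 : Summable fun n => poisWeight l n * (posConst (s n) + posExp (s n)) := by
      simpa only [mul_add] using
        (summable_poisWeight_of_growth hl hl' fun n => growth_posConst (s n)).add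
          (summable_poisWeight_of_growth hl hl' fun n => growth_posExp (s n))
    have h2 := (h1.hasSum.add (ha.mul_left A)).add (ha'.mul_left B)
    refine le_trans (le_of_eq ?_) h
    rw [← h2.tsum_eq]
    refine tsum_congr fun n => ?_
    rw [← poisWeight_mul_exp_neg_poisLog hl hl', ← hs]
    ring

lemma hasSum_poisWeight_mul_ne_zero (l : ℝ) :
    HasSum (fun n => poisWeight l n * if n = 0 then 0 else 1) (1 - Real.exp (-l)) := by
  have h := (hasSum_poisWeight l).sub (hasSum_ite_eq 0 (Real.exp (-l)))
  refine h.congr_fun fun n => ?_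
  split_ifs with hn
  · subst hn; simp [poisWeight]
  · simp

lemma exp_neg_two_le : Real.exp (-2) ≤ 5414 / 40000 := by
  have h1 := Real.exp_one_gt_d9
  have h2 : Real.exp 2 = Real.exp 1 ^ 2 := by rw [← Real.exp_nat_mul]; norm_num
  rw [Real.exp_neg, inv_le_comm₀ (Real.exp_pos _) (by norm_num), h2]
  nlinarith

section

variable {l r : ℝ}

lemma poisLog_mul_exp (hl : 0 < l) (n : ℕ) :
    poisLog l (l * Real.exp r) n = l * (Real.exp r - 1) - n * r := by
  rw [poisLog, mul_div_cancel_left₀ _ hl.ne', Real.log_exp]; ring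

lemma hasSum_poisWeight_poisLog (hl : 0 < l) :
    HasSum (fun n => poisWeight l n * poisLog l (l * Real.exp r) n)
      (l * (Real.exp r - 1 - r)) := by
  simp only [poisLog_mul_exp hl]
  convert hasSum_poisWeight_linear l (l * (Real.exp r - 1)) r using 1
  ring

lemma hasSum_poisWeight_poisLog_sq (hl : 0 < l) :
    HasSum (fun n => poisWeight l n * poisLog l (l * Real.exp r) n ^ 2)
      ((l * (Real.exp r - 1 - r)) ^ 2 + l * r ^ 2) := by
  simp only [poisLog_mul_exp hl]
  convert hasSum_poisWeight_sq l (l * (Real.exp r - 1)) r using 1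
  ring

lemma hasSum_poisWeight_poisLog_quartic (hl : 0 < l) :
    HasSum (fun n => poisWeight l n * poisLog l (l * Real.exp r) n ^ 4)
      ((l * (Real.exp r - 1 - r)) ^ 4 + 6 * (l * (Real.exp r - 1 - r)) ^ 2 * (l * r ^ 2)
        - 4 * (l * (Real.exp r - 1 - r)) * (l * r ^ 3) + 3 * (l * r ^ 2) ^ 2 + l * r ^ 4) := by
  simp only [poisLog_mul_exp hl]
  convert hasSum_poisWeight_quartic l (l * (Real.exp r - 1)) r using 1
  ring

lemma tsum_posPart_le (hl : 0 < l) {G : ℕ → ℝ} {S : ℝ}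
    (hG : HasSum (fun n => poisWeight l n * G n) S)
    (h : ∀ n, posConst (poisLog l (l * Real.exp r) n) + posExp (poisLog l (l * Real.exp r) n)
      ≤ G n) :
    ∑' n, poisWeight l n * (posConst (poisLog l (l * Real.exp r) n) +
      posExp (poisLog l (l * Real.exp r) n)) ≤ S := by
  have hl' : 0 < l * Real.exp r := by positivity
  have h1 := (summable_poisWeight_of_growth hl hl' fun n => growth_posConst _).add
    (summable_poisWeight_of_growth hl hl' fun n => growth_posExp _)
  simp only [← mul_add] at h1
  exact hasSum_le (fun n => mul_le_mul_of_nonneg_left (h n) (poisWeight_pos hl n).le) h1.hasSum hG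

lemma tsum_maj_le (hl : 0 < l) {G : ℕ → ℝ} {S : ℝ}
    (hG : HasSum (fun n => poisWeight l n * G n) S)
    (h : ∀ n, majConst (poisLog l (l * Real.exp r) n) + majExp (poisLog l (l * Real.exp r) n)
      ≤ G n) :
    ∑' n, poisWeight l n * (majConst (poisLog l (l * Real.exp r) n) +
      majExp (poisLog l (l * Real.exp r) n)) ≤ S := by
  have hl' : 0 < l * Real.exp r := by positivity
  have h1 := (summable_poisWeight_of_growth hl hl' fun n => growth_majConst _).add
    (summable_poisWeight_of_growth hl hl' fun n => growth_majExp _)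
  simp only [← mul_add] at h1
  exact hasSum_le (fun n => mul_le_mul_of_nonneg_left (h n) (poisWeight_pos hl n).le) h1.hasSum hG

lemma hasMajorant_of_large_mean (hl : 0 < l) (hK : 3 / 4 ≤ l * (Real.exp r - 1 - r)) :
    HasMajorant l (l * Real.exp r) := by
  have hl' : 0 < l * Real.exp r := by positivity
  refine hasMajorant_of_posPart (r := 2) (c := fun _ => 1) (a := 1) (a' := 1) hl hl' le_rfl
    (fun _ => zero_le_one) (fun _ => le_rfl) (fun _ _ => rfl)
    (by simpa using hasSum_poisWeight l) (by simpa using hasSum_poisWeight (l * Real.exp r)) ?_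
  have hG := (((hasSum_poisWeight_poisLog_sq (r := r) hl).mul_left 2).sub
    ((hasSum_poisWeight_poisLog (r := r) hl).mul_left (3 / 2))).add
    ((hasSum_poisWeight l).mul_left (9 / 16))
  have h1 := tsum_posPart_le (r := r) hl (G := fun n => 2 * poisLog l (l * Real.exp r) n ^ 2
    - 3 / 2 * poisLog l (l * Real.exp r) n + 9 / 16) (hG.congr_fun fun n => by ring)
    fun n => posConst_add_posExp_le_linear _
  rw [(hasSum_poisWeight_poisLog_sq hl).tsum_eq]
  linarith [exp_neg_two_le]

lemma hasMajorant_of_very_negative (hl : 0 < l) (hK : l * (Real.exp r - 1 - r) ≤ 3 / 4)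
    (hr : r ≤ -(7 / 4)) : HasMajorant l (l * Real.exp r) := by
  refine hasMajorant_of_convexMajorant ?_
  rw [← tsum_mul_left]
  have hG := (hasSum_poisWeight_poisLog_sq (r := r) hl).mul_left 2
  rw [hG.tsum_eq]
  refine tsum_maj_le hl (hG.congr_fun fun n => mul_left_comm _ _ _) fun n =>
    majConst_add_majExp_le_sq ?_
  rw [poisLog_mul_exp hl]
  have h1 : l * (1 - Real.exp r) ≤ l * (4 / 3 * (Real.exp r - 1 - r)) :=
    mul_le_mul_of_nonneg_left (by linarith [Real.exp_pos r]) hl.le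
  have h2 : (n : ℝ) * r ≤ 0 := mul_nonpos_of_nonneg_of_nonpos n.cast_nonneg (by linarith)
  linarith

lemma quartic_moment_le (hl : 0 < l) (hK : l * (Real.exp r - 1 - r) ≤ 3 / 4)
    (hr : -(7 / 4) ≤ r) (hr1 : r ≤ 1) :
    2 * (l * (Real.exp r - 1 - r)) + ((l * (Real.exp r - 1 - r)) ^ 2 + l * r ^ 2) / 2 +
      3 / 128 * ((l * (Real.exp r - 1 - r)) ^ 4 + 6 * (l * (Real.exp r - 1 - r)) ^ 2 * (l * r ^ 2)
        - 4 * (l * (Real.exp r - 1 - r)) * (l * r ^ 3) + 3 * (l * r ^ 2) ^ 2 + l * r ^ 4) ≤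
      2 * ((l * (Real.exp r - 1 - r)) ^ 2 + l * r ^ 2) := by
  have hv : 0 ≤ l * r ^ 2 := by positivity
  have hK0 : 0 ≤ l * (Real.exp r - 1 - r) :=
    mul_nonneg hl.le (by linarith [Real.add_one_le_exp r])
  have e3 : l * r ^ 3 = (l * r ^ 2) * r := by ring
  have e4 : l * r ^ 4 = (l * r ^ 2) * r ^ 2 := by ring
  rw [e3, e4]
  rcases le_total r 0 with h0 | h0
  · have h1 : 2 * (l * (Real.exp r - 1 - r)) ≤ l * r ^ 2 := by
      have := exp_neg_sub_le (neg_nonneg.2 h0)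
      rw [neg_neg, neg_sq] at this
      nlinarith
    have h2 : l * r ^ 2 ≤ 4 * (l * (Real.exp r - 1 - r)) := by
      have := sq_div_four_le_exp_sub (show -2 ≤ r by linarith)
      nlinarith
    generalize l * (Real.exp r - 1 - r) = K at *
    generalize l * r ^ 2 = v at *
    have h3 : K ^ 2 ≤ 9 / 16 := by nlinarith
    have h4 : K ^ 4 ≤ K ^ 2 := by nlinarith [sq_nonneg K]
    have h5 : K ^ 2 * v ≤ 9 / 16 * v := mul_le_mul_of_nonneg_right h3 hv
    have h6 : K * -r ≤ 3 / 4 * (7 / 4) := mul_le_mul hK (by linarith) (by linarith) (by norm_num)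
    have h7 : K * -r * v ≤ 3 / 4 * (7 / 4) * v := mul_le_mul_of_nonneg_right h6 hv
    have h8 : v ^ 2 ≤ 3 * v := by nlinarith
    have h9 : r ^ 2 ≤ 49 / 16 := by nlinarith
    have h10 : v * r ^ 2 ≤ v * (49 / 16) := mul_le_mul_of_nonneg_left h9 hv
    nlinarith
  · have h1 : l * (Real.exp r - 1 - r) ≤ 738 / 1000 * (l * r ^ 2) := by
      have h := Real.exp_bound' h0 hr1 (n := 4) (by norm_num)
      norm_num [Finset.sum_range_succ, Nat.factorial] at h
      have h' : Real.exp r - 1 - r ≤ 738 / 1000 * r ^ 2 := by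
        have : r ^ 3 ≤ r ^ 2 := pow_le_pow_of_le_one h0 hr1 (by norm_num)
        have : r ^ 4 ≤ r ^ 2 := pow_le_pow_of_le_one h0 hr1 (by norm_num)
        linarith [sq_nonneg r]
      nlinarith
    have h2 : l * r ^ 2 ≤ 2 * (l * (Real.exp r - 1 - r)) := by
      have := Real.quadratic_le_exp_of_nonneg h0
      nlinarith
    generalize l * (Real.exp r - 1 - r) = K at *
    generalize l * r ^ 2 = v at *
    have h3 : K ^ 2 ≤ 9 / 16 := by nlinarith
    have h4 : K ^ 4 ≤ K ^ 2 := by nlinarith [sq_nonneg K]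
    have h5 : K ^ 2 * v ≤ K ^ 2 * (3 / 2) := mul_le_mul_of_nonneg_left (by linarith) (sq_nonneg K)
    have h6 : 0 ≤ K * (v * r) := by positivity
    have h7 : v ^ 2 ≤ 4 * K ^ 2 := by nlinarith
    have h8 : v * r ^ 2 ≤ v := mul_le_of_le_one_right hv (by nlinarith)
    nlinarith

lemma hasMajorant_of_moderate (hl : 0 < l) (hK : l * (Real.exp r - 1 - r) ≤ 3 / 4)
    (hr : -(7 / 4) ≤ r) (hr1 : r ≤ 1) : HasMajorant l (l * Real.exp r) := by
  refine hasMajorant_of_convexMajorant ?_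
  have hl' : 0 < l * Real.exp r := by positivity
  have h1 := hasSum_poisWeight_poisLog (r := r) hl
  have h2 := hasSum_poisWeight_poisLog_sq (r := r) hl
  have h4 := hasSum_poisWeight_poisLog_quartic (r := r) hl
  have hG := ((((((hasSum_poisWeight_exp_neg_poisLog hl hl').sub (hasSum_poisWeight l)).add
    h1).mul_left 2).add (h2.mul_left (1 / 2))).add (h4.mul_left (3 / 128)))
  refine (tsum_maj_le (r := r) hl (hG.congr_fun fun n => ?_) fun n =>
    majConst_add_majExp_le_quartic _).trans ?_
  · ring
  · rw [h2.tsum_eq]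
    linarith [quartic_moment_le hl hK hr hr1]

lemma two_thirds_mul_le_exp_sub (hr : 1 ≤ r) : 2 / 3 * r ≤ Real.exp r - 1 - r := by
  have h := Real.sum_le_exp_of_nonneg (zero_le_one.trans hr) 4
  norm_num [Finset.sum_range_succ, Nat.factorial] at h
  nlinarith [mul_nonneg (sub_nonneg.2 hr) (sub_nonneg.2 hr),
    mul_nonneg (sub_nonneg.2 hr) (sq_nonneg r)]

lemma poisLog_le_two (hl : 0 < l) (hK : l * (Real.exp r - 1 - r) ≤ 3 / 4) (hr : 1 ≤ r) (n : ℕ) :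
    poisLog l (l * Real.exp r) n ≤ 2 := by
  rw [poisLog_mul_exp hl]
  have h1 := mul_le_mul_of_nonneg_left (two_thirds_mul_le_exp_sub hr) hl.le
  have h2 : 0 ≤ (n : ℝ) * r := by positivity
  linarith

lemma hasMajorant_of_pooled (hl : 0 < l) (hr : 1 ≤ r) {b : ℝ} (hb : 2 ≤ b)
    (h : ∑' n, poisWeight l n * (posConst (poisLog l (l * Real.exp r) n) +
        posExp (poisLog l (l * Real.exp r) n)) +
      (b ^ 2 - 2 * b) * (1 - Real.exp (-l)) +
      2 * b * Real.exp (-b) * (1 - Real.exp (-(l * Real.exp r))) ≤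
      2 * ((l * (Real.exp r - 1 - r)) ^ 2 + l * r ^ 2)) : HasMajorant l (l * Real.exp r) := by
  have hl' : 0 < l * Real.exp r := by positivity
  refine hasMajorant_of_posPart (c := fun n => if n = 0 then 0 else 1) hl hl' hb
    (fun n => by positivity) (fun n => by split_ifs <;> norm_num) (fun n hn => ?_)
    (hasSum_poisWeight_mul_ne_zero l) (hasSum_poisWeight_mul_ne_zero _) ?_
  · refine if_neg (hn.resolve_right ?_)
    rw [poisLog_mul_exp hl, Nat.cast_zero, zero_mul, sub_zero, not_lt]
    exact mul_nonneg hl.le (by linarith [Real.add_one_le_exp r])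
  · rwa [(hasSum_poisWeight_poisLog_sq hl).tsum_eq]

lemma hasMajorant_of_two_le (hl : 0 < l) (hK : l * (Real.exp r - 1 - r) ≤ 3 / 4)
    (hr : 2 ≤ r) : HasMajorant l (l * Real.exp r) := by
  have hr1 : 1 ≤ r := by linarith
  refine hasMajorant_of_pooled hl hr1 hr ?_
  have h1 := tsum_posPart_le hl (hasSum_poisWeight_poisLog_sq (r := r) hl) fun n =>
    posConst_add_posExp_le_sq (poisLog_le_two hl hK hr1 n)
  have h2 : (r ^ 2 - 2 * r) * (1 - Real.exp (-l)) ≤ (r ^ 2 - 2 * r) * l :=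
    mul_le_mul_of_nonneg_left (by linarith [Real.add_one_le_exp (-l)]) (by nlinarith)
  have h3 : 2 * r * Real.exp (-r) * (1 - Real.exp (-(l * Real.exp r))) ≤
      2 * r * Real.exp (-r) * (l * Real.exp r) :=
    mul_le_mul_of_nonneg_left (by linarith [Real.add_one_le_exp (-(l * Real.exp r))])
      (by positivity)
  have h4 : Real.exp (-r) * Real.exp r = 1 := by rw [← Real.exp_add]; simp
  have h5 : 2 * r * Real.exp (-r) * (l * Real.exp r) = 2 * r * l := by
    linear_combination 2 * r * l * h4
  nlinarith [sq_nonneg (l * (Real.exp r - 1 - r))]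

lemma exp_le_quadratic_form (hr : 1 ≤ r) (hr2 : r ≤ 2) :
    5414 / 10000 * Real.exp r ≤ r ^ 2 + 82 / 100 * (Real.exp r - 1 - r) * r
      - 1681 / 10000 * (Real.exp r - 1 - r) ^ 2 := by
  obtain ⟨v, rfl⟩ : ∃ v, r = 1 + v := ⟨r - 1, by ring⟩
  have hv0 : 0 ≤ v := by linarith
  have hv1 : v ≤ 1 := by linarith
  have h1 := Real.exp_one_gt_d9
  have h2 := Real.exp_one_lt_d9
  have h3 := Real.quadratic_le_exp_of_nonneg hv0
  have h4 : Real.exp v ≤ 1 + v + 72 / 100 * v ^ 2 := by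
    have h := Real.exp_bound' hv0 hv1 (n := 4) (by norm_num)
    norm_num [Finset.sum_range_succ, Nat.factorial] at h
    have : v ^ 3 ≤ v ^ 2 := pow_le_pow_of_le_one hv0 hv1 (by norm_num)
    have : v ^ 4 ≤ v ^ 2 := pow_le_pow_of_le_one hv0 hv1 (by norm_num)
    linarith
  have h5 : 2.718 * (1 + v + v ^ 2 / 2) ≤ Real.exp (1 + v) := by
    rw [Real.exp_add]; exact mul_le_mul (by linarith) h3 (by positivity) (by positivity)
  have h6 : Real.exp (1 + v) ≤ 2.7183 * (1 + v + 72 / 100 * v ^ 2) := by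
    rw [Real.exp_add]; exact mul_le_mul (by linarith) h4 (by positivity) (by positivity)
  generalize Real.exp (1 + v) = x at *
  have h7 := mul_nonneg (sub_nonneg.2 h5) (sub_nonneg.2 h6)
  have h8 : v ^ 3 ≤ v ^ 2 := pow_le_pow_of_le_one hv0 hv1 (by norm_num)
  have h9 : v ^ 4 ≤ v ^ 2 := pow_le_pow_of_le_one hv0 hv1 (by norm_num)
  nlinarith

lemma hasMajorant_of_one_le_le_two (hl : 0 < l) (hK : l * (Real.exp r - 1 - r) ≤ 3 / 4)
    (hr : 1 ≤ r) (hr2 : r ≤ 2) : HasMajorant l (l * Real.exp r) := by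
  refine hasMajorant_of_pooled hl hr le_rfl ?_
  have hb := exp_neg_two_le
  have ha1 : Real.exp (-2) * (1 - Real.exp (-(l * Real.exp r))) ≤ 5414 / 40000 * 1 :=
    mul_le_mul hb (by linarith [Real.exp_pos (-(l * Real.exp r))])
      (by rw [sub_nonneg, Real.exp_le_one_iff]; nlinarith [Real.exp_pos r]) (by norm_num)
  have ha2 : Real.exp (-2) * (1 - Real.exp (-(l * Real.exp r))) ≤
      5414 / 40000 * (l * Real.exp r) :=
    mul_le_mul hb (by linarith [Real.add_one_le_exp (-(l * Real.exp r))])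
      (by rw [sub_nonneg, Real.exp_le_one_iff]; nlinarith [Real.exp_pos r]) (by norm_num)
  have hs2 := poisLog_le_two hl hK hr
  rcases lt_or_ge r (l * (Real.exp r - 1)) with hy | hy
  · have h1 := tsum_posPart_le hl (hasSum_poisWeight_poisLog_sq (r := r) hl) fun n =>
      posConst_add_posExp_le_sq (hs2 n)
    have h2 : 3 / 4 ≤ (l * (Real.exp r - 1 - r)) ^ 2 + l * r ^ 2 := by
      rcases le_total 1 l with h | h
      · nlinarith [sq_nonneg (l * (Real.exp r - 1 - r))]
      · have h3 : (1 - l) * r ≤ l * (Real.exp r - 1 - r) := by linarith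
        have h4 : ((1 - l) * r) ^ 2 ≤ (l * (Real.exp r - 1 - r)) ^ 2 :=
          pow_le_pow_left₀ (mul_nonneg (by linarith) (by linarith)) h3 2
        have h5 : 3 / 4 * r ^ 2 ≤ ((1 - l) ^ 2 + l) * r ^ 2 :=
          mul_le_mul_of_nonneg_right (by nlinarith [sq_nonneg (l - 1 / 2)]) (sq_nonneg r)
        nlinarith
    linarith
  · have h1 := tsum_posPart_le (r := r) hl (G := fun n => if n = 0 then
        (l * (Real.exp r - 1)) ^ 2 else 0) (S := Real.exp (-l) * (l * (Real.exp r - 1)) ^ 2)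
        ((hasSum_ite_eq 0 _).congr_fun fun n => ?_) fun n => ?_
    rotate_left
    · split_ifs with hn
      · subst hn; simp [poisWeight]
      · simp
    · split_ifs with hn
      · refine (posConst_add_posExp_le_sq (hs2 n)).trans_eq ?_
        rw [poisLog_mul_exp hl, hn]; simp
      · refine posConst_add_posExp_nonpos ?_
        rw [poisLog_mul_exp hl]
        have : (1 : ℝ) ≤ n := by exact_mod_cast Nat.one_le_iff_ne_zero.2 hn
        nlinarith
    have h2 : Real.exp (-l) * (1 + l) ≤ 1 := by
      have h3 : Real.exp (-l) * Real.exp l = 1 := by rw [← Real.exp_add]; simp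
      rw [← h3]
      exact mul_le_mul_of_nonneg_left (by linarith [Real.add_one_le_exp l]) (Real.exp_pos _).le
    have hq := exp_le_quadratic_form hr hr2
    set x := Real.exp r
    obtain ⟨g, hg⟩ : ∃ g, g = x - 1 - r := ⟨_, rfl⟩
    have hx : x = 1 + r + g := by linarith
    have hmain : (l * (x - 1)) ^ 2 + 5414 / 10000 * (l * x) * (1 + l) ≤
        2 * ((l * (x - 1 - r)) ^ 2 + l * r ^ 2) * (1 + l) := by
      rw [← hg] at hq ⊢
      have h3 : 5414 / 10000 * x * (1 + l) ≤ (l * g ^ 2 + r ^ 2) * (1 + l) + (r - l * g) ^ 2 := by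
        have h4 := sq_nonneg (r - l * g - 41 / 100 * g * (1 + l))
        have h5 := mul_le_mul_of_nonneg_right hq (show 0 ≤ 1 + l by linarith)
        have h6 : 0 ≤ l * g ^ 2 * (1 + l) := by positivity
        nlinarith
      have h7 := mul_le_mul_of_nonneg_left h3 hl.le
      have e : l * (x - 1) = l * (r + g) := by rw [hx]; ring
      rw [e]
      linarith
    have h8 : Real.exp (-l) * (l * (x - 1)) ^ 2 * (1 + l) ≤ (l * (x - 1)) ^ 2 := by
      nlinarith [sq_nonneg (l * (x - 1))]
    have h9 : Real.exp (-l) * (l * (x - 1)) ^ 2 + 5414 / 10000 * (l * x) ≤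
        2 * ((l * (x - 1 - r)) ^ 2 + l * r ^ 2) := by
      refine le_of_mul_le_mul_right ?_ (show 0 < 1 + l by linarith)
      linarith
    linarith

lemma hasMajorant (hl : 0 < l) : HasMajorant l (l * Real.exp r) := by
  rcases le_total (3 / 4) (l * (Real.exp r - 1 - r)) with hK | hK
  · exact hasMajorant_of_large_mean hl hK
  rcases le_total r (-(7 / 4)) with h1 | h1
  · exact hasMajorant_of_very_negative hl hK h1
  rcases le_total r 1 with h2 | h2
  · exact hasMajorant_of_moderate hl hK h1 h2
  rcases le_total r 2 with h3 | h3
  · exact hasMajorant_of_one_le_le_two hl hK h2 h3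
  · exact hasMajorant_of_two_le hl hK h3

end

/-- V(q, q′) ≤ 2∑_n e^{−λ}(λⁿ/n!)(V(p^{∗n}, p′^{∗n}) + 2KL(p^{∗n}, p′^{∗n}))
+ 2V(Poisson(λ), Poisson(λ′)). -/
theorem stmt14 (lam lam' : ℝ) (hl : 0 < lam) (hl' : 0 < lam')
    (p p' : ℕ → ℝ) (hp : IsPMF p) (hp' : IsPMF p') (h0 : p 0 = 0) (h0' : p' 0 = 0)
    (habs : ∀ i, 0 < p i → 0 < p' i)
    (hKL : ∀ n : ℕ, Summable fun i =>
      convPow p n i * Real.log (convPow p n i / convPow p' n i))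
    (hV : ∀ n : ℕ, Summable fun i =>
      convPow p n i * (Real.log (convPow p n i / convPow p' n i)) ^ 2) :
    Vd (cpq lam p) (cpq lam' p') ≤
      2 * (∑' n : ℕ, Real.exp (-lam) * lam ^ n / (Nat.factorial n : ℝ) *
        (Vd (convPow p n) (convPow p' n) + 2 * KL (convPow p n) (convPow p' n))) +
      2 * (∑' n : ℕ, Real.exp (-lam) * lam ^ n / (Nat.factorial n : ℝ) *
        (Real.log ((Real.exp (-lam) * lam ^ n) / (Real.exp (-lam') * lam' ^ n))) ^ 2) := by
  obtain ⟨e, f, C, hf, hCe, hCf, hmain, hsum⟩ : HasMajorant lam lam' := by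
    have h := hasMajorant (r := Real.log (lam' / lam)) hl
    rwa [Real.exp_log (div_pos hl' hl), mul_div_cancel₀ _ hl.ne'] at h
  refine (Vd_cpq_le_of_majorant hl hl' hp hp' h0 h0' habs hKL hV hf hCe hCf hmain).trans ?_
  simp only [log_poisWeight_ratio hl hl']
  exact add_le_add_right hsum _
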